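/- For every integer k ≥ 1 and real λ > 0, [1/λ + 1/(λk) − H_{k+1}/(λk)] + [((H_{(k+1)²} − 1) + k·H_{(k+1)²})/(2λ(k+1)H_k)] + [(k+2)(H_{k+1}−1)²/(2k(k+1)λH_k) + k·H_{k+1}²/(2(k+1)λH_k) + (H_{k+1}−1)H_{k+1}/((k+1)λH_k)] = 1/λ + H_k/(2λ) + H_{k²}/(2λH_k). -/

import Mathlib

open MeasureTheory ProbabilityTheory Real Finset Filter

/-- The `k`-th order statistic (1-indexed: the `k`-th smallest) of `n` real values. -/
noncomputable def orderStat {n : ℕ} (k : ℕ) (x : Fin n → ℝ) : ℝ :=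
  ((Finset.univ.val.map x).sort (· ≤ ·)).getD (k - 1) 0

/-- The `n`-th harmonic number `H_n = ∑_{j=1}^n 1/j`. -/
noncomputable def H (n : ℕ) : ℝ := ∑ j ∈ Finset.Icc 1 n, (1 : ℝ) / j

/-- The generalized harmonic number of order 2, `H_{n²} = ∑_{j=1}^n 1/j²`. -/
noncomputable def H2 (n : ℕ) : ℝ := ∑ j ∈ Finset.Icc 1 n, (1 : ℝ) / j ^ 2

/-- `X` has the shifted exponential distribution with rate `lam` and shift `c`:
its CDF is `1 - exp (-lam * (x - c))` for `x ≥ c` and `0` otherwise. -/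
def IsShiftedExp {Ω : Type*} [MeasurableSpace Ω] (μ : Measure Ω) (X : Ω → ℝ)
    (lam c : ℝ) : Prop :=
  ∀ x : ℝ, μ {ω | X ω ≤ x} =
    ENNReal.ofReal (if c ≤ x then 1 - Real.exp (-lam * (x - c)) else 0)

/-- `δ_0(k) + δ_1(k) + δ_2(k) = 1/λ + H_k/(2λ) + H_{k²}/(2λH_k)`: for exponential
service times the average age at a non-priority node equals that at a priority node. -/
theorem delta_sum_identity (k : ℕ) (hk : 1 ≤ k) (lam : ℝ) (hlam : 0 < lam) :
    (1 / lam + 1 / (lam * k) - H (k + 1) / (lam * k))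
      + ((H2 (k + 1) - 1) + k * H2 (k + 1)) / (2 * lam * (k + 1) * H k)
      + ((k + 2) * (H (k + 1) - 1) ^ 2 / (2 * k * (k + 1) * lam * H k)
        + k * H (k + 1) ^ 2 / (2 * (k + 1) * lam * H k)
        + (H (k + 1) - 1) * H (k + 1) / ((k + 1) * lam * H k))
      = 1 / lam + H k / (2 * lam) + H2 k / (2 * lam * H k) := by
  have hk0 : (0 : ℝ) < k := by exact_mod_cast hk
  have h1 : H (k + 1) = H k + 1 / ((k : ℝ) + 1) := by
    unfold H
    rw [Finset.sum_Icc_succ_top (by omega)]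
    push_cast
    rfl
  have h2 : H2 (k + 1) = H2 k + 1 / ((k : ℝ) + 1) ^ 2 := by
    unfold H2
    rw [Finset.sum_Icc_succ_top (by omega)]
    push_cast
    rfl
  have hH : 0 < H k := by
    unfold H
    apply Finset.sum_pos
    · intro j hj
      have : 0 < j := (Finset.mem_Icc.mp hj).1
      positivity
    · exact ⟨1, Finset.mem_Icc.mpr ⟨le_refl 1, hk⟩⟩
  rw [h1, h2]
  generalize H k = a at *
  generalize H2 k = b at *
  generalize (k : ℝ) = x at *
  have hx : x + 1 ≠ 0 := by positivity
  field_simp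
  ring
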